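/- arXiv:2406.16399 — 3 statements merged into one kernel-verified Lean document; each statement's English description precedes it below -/
import Mathlib

section
/- The set of permutations of size n avoiding 231 and 4213 is in bijection with the set of Motzkin paths with a total of n up and horizontal steps, having no peaks (no up step immediately followed by a down step), and such that every maximal run of down steps ends at height 0. -/
/-- `π` is a permutation of `{1,…,n}`, encoded as the list of its values. -/
def IsPermList (n : ℕ) (π : List ℕ) : Prop := π.Perm (List.range' 1 n)

/-- The pattern `σ` occurs in `π`: some subsequence of `π` is order-isomorphic to `σ`. -/
def Contains (π σ : List ℕ) : Prop :=
  ∃ τ : List ℕ, τ.Sublist π ∧ τ.length = σ.length ∧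
    ∀ i j : ℕ, i < τ.length → j < τ.length → (τ[i]! < τ[j]! ↔ σ[i]! < σ[j]!)

/-- `π` avoids the pattern `σ`. -/
def Avoids (π σ : List ℕ) : Prop := ¬ Contains π σ

/-- The pop stack with bypass sorting procedure (algorithm PSB); the second
argument is the pop stack, stored top-first.  Push if the stack is empty or the
current element is `TOP - 1`; bypass if it is `< TOP - 1`; otherwise pop the
whole stack and push.  At the end the stack is popped. -/
def psbAux : List ℕ → List ℕ → List ℕ
  | [], s => s
  | x :: xs, [] => psbAux xs [x]
  | x :: xs, t :: s =>
      if x + 1 = t then psbAux xs (x :: t :: s)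
      else if x + 1 < t then x :: psbAux xs (t :: s)
      else (t :: s) ++ psbAux xs [x]

/-- The map associated with the PSB algorithm. -/
def psb (π : List ℕ) : List ℕ := psbAux π []

/-- A Motzkin path, encoded as its list of steps (`1` = up, `0` = horizontal,
`-1` = down): it stays weakly above the axis and ends at height `0`. -/
def IsMotzkin (p : List ℤ) : Prop :=
  (∀ s ∈ p, s = 1 ∨ s = 0 ∨ s = -1) ∧
    (∀ i ≤ p.length, 0 ≤ (p.take i).sum) ∧ p.sum = 0

/-- No up step is immediately followed by a down step. -/
def NoPeak (p : List ℤ) : Prop :=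
  ∀ i, i + 1 < p.length → ¬(p[i]! = 1 ∧ p[i + 1]! = -1)

/-- Every maximal run of down steps ends at height `0`. -/
def DownRunsReachBottom (p : List ℤ) : Prop :=
  ∀ i < p.length, p[i]! = -1 → (i + 1 = p.length ∨ p[i + 1]! ≠ -1) →
    (p.take (i + 1)).sum = 0

/-- The total number of up and horizontal steps of `p`. -/
def upHorizCount (p : List ℤ) : ℕ := p.countP (fun s => decide (s ≠ -1))

theorem contains_231_iff {π : List ℕ} :
    Contains π [2, 3, 1] ↔ ∃ a b c, [a, b, c].Sublist π ∧ c < a ∧ a < b := by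
  constructor
  · rintro ⟨τ, hs, hl, h⟩
    match τ, hl with
    | [a, b, c], _ =>
      have h₁ := h 2 0 (by simp) (by simp)
      have h₂ := h 0 1 (by simp) (by simp)
      exact ⟨a, b, c, hs, by simpa using h₁, by simpa using h₂⟩
  · rintro ⟨a, b, c, hs, hca, hab⟩
    refine ⟨[a, b, c], hs, rfl, fun i j hi hj => ?_⟩
    simp only [List.length_cons, List.length_nil] at hi hj
    interval_cases i <;> interval_cases j <;> simp <;> omega

theorem contains_4213_iff {π : List ℕ} :
    Contains π [4, 2, 1, 3] ↔
      ∃ a b c d, [a, b, c, d].Sublist π ∧ c < b ∧ b < d ∧ d < a := by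
  constructor
  · rintro ⟨τ, hs, hl, h⟩
    match τ, hl with
    | [a, b, c, d], _ =>
      have h₁ := h 2 1 (by simp) (by simp)
      have h₂ := h 1 3 (by simp) (by simp)
      have h₃ := h 3 0 (by simp) (by simp)
      exact ⟨a, b, c, d, hs, by simpa using h₁, by simpa using h₂, by simpa using h₃⟩
  · rintro ⟨a, b, c, d, hs, hcb, hbd, hda⟩
    refine ⟨[a, b, c, d], hs, rfl, fun i j hi hj => ?_⟩
    simp only [List.length_cons, List.length_nil] at hi hj
    interval_cases i <;> interval_cases j <;> simp <;> omega

theorem perm_range'_iff {k n : ℕ} {π : List ℕ} :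
    π.Perm (List.range' k n) ↔ π.Nodup ∧ ∀ y, y ∈ π ↔ k ≤ y ∧ y < k + n := by
  constructor
  · intro h
    exact ⟨h.nodup_iff.2 List.nodup_range', fun y => by rw [h.mem_iff, List.mem_range'_1]⟩
  · rintro ⟨h, hm⟩
    rw [List.perm_ext_iff_of_nodup h List.nodup_range']
    intro y
    rw [hm, List.mem_range'_1]

/-- The arrangement of `{k, …, k + |v|}` whose successive entries are the maximum (`true`) or the
minimum (`false`) of the values not yet used, as prescribed by the word `v`. -/
def extremalList : ℕ → List Bool → List ℕ
  | k, [] => [k]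
  | k, true :: v => (k + v.length + 1) :: extremalList k v
  | k, false :: v => k :: extremalList (k + 1) v

theorem extremalList_perm (k : ℕ) (v : List Bool) :
    (extremalList k v).Perm (List.range' k (v.length + 1)) := by
  induction v generalizing k with
  | nil => simp [extremalList]
  | cons b v ih =>
    cases b
    · rw [List.length_cons, List.range'_succ]
      exact (ih (k + 1)).cons k
    · rw [List.length_cons, List.range'_1_concat]
      exact ((ih k).cons _).trans (List.perm_append_singleton _ _).symm

theorem mem_extremalList {k y : ℕ} {v : List Bool} :
    y ∈ extremalList k v ↔ k ≤ y ∧ y < k + (v.length + 1) :=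
  (perm_range'_iff.1 (extremalList_perm k v)).2 y

theorem length_extremalList (k : ℕ) (v : List Bool) :
    (extremalList k v).length = v.length + 1 := by
  simpa using (extremalList_perm k v).length_eq

theorem extremalList_injective (k : ℕ) : Function.Injective (extremalList k) := by
  intro v
  induction v generalizing k with
  | nil =>
    intro w h
    have := congrArg List.length h
    simp only [length_extremalList, List.length_nil] at this
    exact (List.length_eq_zero_iff.1 (by omega)).symm
  | cons b v ih =>
    intro w h
    have hl := congrArg List.length h
    simp only [length_extremalList, List.length_cons] at hl
    match b, w with
    | _, [] => simp at hl
    | true, true :: w => rw [ih k (List.cons.inj h).2]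
    | false, false :: w => rw [ih (k + 1) (List.cons.inj h).2]
    | true, false :: w => have := (List.cons.inj h).1; omega
    | false, true :: w => have := (List.cons.inj h).1; omega

theorem extremalList_extremal {k a b c : ℕ} {v : List Bool}
    (h : [a, b, c].Sublist (extremalList k v)) : a < b ∧ a < c ∨ b < a ∧ c < a := by
  induction v generalizing k with
  | nil => simpa [extremalList] using h.length_le
  | cons d v ih =>
    cases d <;> rw [extremalList, List.cons_sublist_cons'] at h <;>
      obtain h | ⟨rfl, h⟩ := h
    · exact ih h
    · have hb := mem_extremalList.1 (h.subset (show b ∈ [b, c] by simp))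
      have hc := mem_extremalList.1 (h.subset (show c ∈ [b, c] by simp))
      omega
    · exact ih h
    · have hb := mem_extremalList.1 (h.subset (show b ∈ [b, c] by simp))
      have hc := mem_extremalList.1 (h.subset (show c ∈ [b, c] by simp))
      omega

theorem pair_sublist_or_of_mem {α : Type*} {l : List α} {b c : α} (hb : b ∈ l) (hc : c ∈ l)
    (hne : b ≠ c) : [b, c].Sublist l ∨ [c, b].Sublist l := by
  induction l with
  | nil => simp at hb
  | cons a l ih =>
    rcases List.mem_cons.1 hb with rfl | hb'
    · rcases List.mem_cons.1 hc with rfl | hc'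
      · exact absurd rfl hne
      · exact .inl ((List.singleton_sublist.2 hc').cons_cons _)
    · rcases List.mem_cons.1 hc with rfl | hc'
      · exact .inr ((List.singleton_sublist.2 hb').cons_cons _)
      · exact (ih hb' hc').imp (List.Sublist.cons _) (List.Sublist.cons _)

theorem exists_eq_extremalList {r k : ℕ} {σ : List ℕ} (hσ : σ.Perm (List.range' k (r + 1)))
    (hext : ∀ a b c, [a, b, c].Sublist σ → ¬(c < a ∧ a < b) ∧ ¬(b < a ∧ a < c)) :
    ∃ v : List Bool, v.length = r ∧ σ = extremalList k v := by
  induction r generalizing k σ with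
  | zero => exact ⟨[], rfl, by simpa [extremalList] using hσ⟩
  | succ r ih =>
    cases σ with
    | nil => simpa using hσ.length_eq
    | cons y τ =>
      have htail : ∀ a b c, [a, b, c].Sublist τ → ¬(c < a ∧ a < b) ∧ ¬(b < a ∧ a < c) :=
        fun a b c h => hext a b c (h.cons _)
      have hmem := (perm_range'_iff.1 hσ).2
      have hy := (hmem y).1 (by simp)
      by_cases hmin : y = k
      · subst hmin
        rw [List.range'_succ] at hσ
        obtain ⟨v, hv, rfl⟩ := ih ((List.perm_cons y).1 hσ) htail
        exact ⟨false :: v, by simp [hv], rfl⟩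
      by_cases hmax : y = k + (r + 1)
      · subst hmax
        rw [List.range'_1_concat] at hσ
        obtain ⟨v, hv, rfl⟩ :=
          ih ((List.perm_cons _).1 (hσ.trans (List.perm_append_singleton _ _))) htail
        exact ⟨true :: v, by simp [hv], by simp [extremalList, hv, add_assoc]⟩
      have hb : k ∈ τ := by
        have := (hmem k).2 (by omega)
        rw [List.mem_cons] at this
        exact this.resolve_left (Ne.symm hmin)
      have hc : k + (r + 1) ∈ τ := by
        have := (hmem (k + (r + 1))).2 (by omega)
        rw [List.mem_cons] at this
        exact this.resolve_left (Ne.symm hmax)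
      rcases pair_sublist_or_of_mem hb hc (by omega) with h | h
      · exact absurd ⟨by omega, by omega⟩ (hext _ _ _ (h.cons_cons y)).2
      · exact absurd ⟨by omega, by omega⟩ (hext _ _ _ (h.cons_cons y)).1

/-- Lists of blocks of total size `n`: a block is a word that does not start with `false`, and has
size one more than its length. -/
def IsBlockList (n : ℕ) (l : List (List Bool)) : Prop :=
  (∀ v ∈ l, v.head? ≠ some false) ∧ (l.map fun v => v.length + 1).sum = n

theorem isBlockList_cons {n : ℕ} {v : List Bool} {l : List (List Bool)} :
    IsBlockList n (v :: l) ↔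
      v.head? ≠ some false ∧ ∃ m, IsBlockList m l ∧ n = v.length + 1 + m := by
  simp only [IsBlockList, List.forall_mem_cons, List.map_cons, List.sum_cons]
  constructor
  · rintro ⟨⟨h₁, h₂⟩, h₃⟩
    exact ⟨h₁, _, ⟨h₂, rfl⟩, h₃.symm⟩
  · rintro ⟨h₁, m, ⟨h₂, rfl⟩, h₃⟩
    exact ⟨⟨h₁, h₂⟩, h₃.symm⟩

/-- The permutation, with values starting at `k`, that is the direct sum of the blocks. -/
def blockPerm : ℕ → List (List Bool) → List ℕ
  | _, [] => []
  | k, v :: l => extremalList k v ++ blockPerm (k + (v.length + 1)) l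

theorem blockPerm_perm {k n : ℕ} {l : List (List Bool)} (hl : IsBlockList n l) :
    (blockPerm k l).Perm (List.range' k n) := by
  induction l generalizing k n with
  | nil => obtain ⟨-, rfl⟩ := hl; simp [blockPerm]
  | cons v l ih =>
    obtain ⟨-, m, hm, rfl⟩ := isBlockList_cons.1 hl
    rw [← List.range'_append_1]
    exact (extremalList_perm k v).append (ih hm)

theorem le_of_mem_blockPerm {k y : ℕ} {l : List (List Bool)} (hy : y ∈ blockPerm k l) :
    k ≤ y := by
  induction l generalizing k with
  | nil => simp [blockPerm] at hy
  | cons v l ih =>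
    rcases List.mem_append.1 hy with h | h
    · exact (mem_extremalList.1 h).1
    · have := ih h
      omega

theorem lt_of_mem_extremalList_of_mem_blockPerm {k y z : ℕ} {v : List Bool}
    {l : List (List Bool)} (hy : y ∈ extremalList k v)
    (hz : z ∈ blockPerm (k + (v.length + 1)) l) : y < z :=
  (mem_extremalList.1 hy).2.trans_le (le_of_mem_blockPerm hz)

theorem avoids_231_blockPerm (k : ℕ) (l : List (List Bool)) :
    Avoids (blockPerm k l) [2, 3, 1] := by
  rw [Avoids, contains_231_iff]
  rintro ⟨a, b, c, h, hca, hab⟩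
  induction l generalizing k with
  | nil => simp [blockPerm] at h
  | cons v l ih =>
    obtain ⟨s, t, hst, hs, ht⟩ := List.sublist_append_iff.1 h
    have hlt : ∀ y ∈ s, ∀ z ∈ t, y < z := fun y hy z hz =>
      lt_of_mem_extremalList_of_mem_blockPerm (hs.subset hy) (ht.subset hz)
    rcases s with _ | ⟨a', _ | ⟨b', _ | ⟨c', s⟩⟩⟩ <;> simp at hst
    · subst hst; exact ih _ ht
    · obtain ⟨rfl, rfl⟩ := hst; have := hlt a (by simp) c (by simp); omega
    · obtain ⟨rfl, rfl, rfl⟩ := hst; have := hlt a (by simp) c (by simp); omega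
    · obtain ⟨rfl, rfl, rfl, rfl, rfl⟩ := hst
      have := extremalList_extremal hs
      omega

theorem avoids_4213_blockPerm (k : ℕ) (l : List (List Bool)) :
    Avoids (blockPerm k l) [4, 2, 1, 3] := by
  rw [Avoids, contains_4213_iff]
  rintro ⟨a, b, c, d, h, hcb, hbd, hda⟩
  induction l generalizing k with
  | nil => simp [blockPerm] at h
  | cons v l ih =>
    obtain ⟨s, t, hst, hs, ht⟩ := List.sublist_append_iff.1 h
    have hlt : ∀ y ∈ s, ∀ z ∈ t, y < z := fun y hy z hz =>
      lt_of_mem_extremalList_of_mem_blockPerm (hs.subset hy) (ht.subset hz)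
    rcases s with _ | ⟨a', _ | ⟨b', _ | ⟨c', _ | ⟨d', s⟩⟩⟩⟩ <;> simp at hst
    · subst hst; exact ih _ ht
    · obtain ⟨rfl, rfl⟩ := hst; have := hlt a (by simp) d (by simp); omega
    · obtain ⟨rfl, rfl, rfl⟩ := hst; have := hlt a (by simp) d (by simp); omega
    · obtain ⟨rfl, rfl, rfl, rfl⟩ := hst; have := hlt a (by simp) d (by simp); omega
    · obtain ⟨rfl, rfl, rfl, rfl, rfl, rfl⟩ := hst
      have := extremalList_extremal ((List.sublist_cons_self _ _).trans hs)
      omega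

theorem head_extremalList {k : ℕ} {v : List Bool} (hv : v.head? ≠ some false) :
    (extremalList k v).head? = some (k + v.length) := by
  match v, hv with
  | [], _ => rfl
  | true :: v, _ => rfl

theorem blockPerm_injOn {k n n' : ℕ} {l l' : List (List Bool)} (hl : IsBlockList n l)
    (hl' : IsBlockList n' l') (h : blockPerm k l = blockPerm k l') : l = l' := by
  have hne : ∀ k v, extremalList k v ≠ [] := fun k v hv => by
    simpa [hv] using length_extremalList k v
  induction l generalizing k n n' l' with
  | nil =>
    cases l' with
    | nil => rfl
    | cons v' l' => simp [blockPerm, hne] at h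
  | cons v l ih =>
    cases l' with
    | nil => simp [blockPerm, hne] at h
    | cons v' l' =>
      obtain ⟨hv, m, hm, -⟩ := isBlockList_cons.1 hl
      obtain ⟨hv', m', hm', -⟩ := isBlockList_cons.1 hl'
      have hhead := congrArg List.head? h
      simp only [blockPerm, List.head?_append, head_extremalList hv, head_extremalList hv',
        Option.some_or, Option.some.injEq, Nat.add_left_cancel_iff] at hhead
      obtain ⟨h₁, h₂⟩ := List.append_inj h (by simp [length_extremalList, hhead])
      rw [hhead] at h₂
      rw [extremalList_injective k h₁, ih hm hm' h₂]

theorem Avoids.of_sublist {π ρ σ : List ℕ} (h : Avoids π σ) (hρ : ρ.Sublist π) : Avoids ρ σ :=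
  fun ⟨τ, hτ, hτ'⟩ => h ⟨τ, hτ.trans hρ, hτ'⟩

theorem exists_split_of_avoids_231 {x : ℕ} {ρ : List ℕ} (hx : x ∉ ρ)
    (h : Avoids (x :: ρ) [2, 3, 1]) :
    ∃ s t, ρ = s ++ t ∧ (∀ y ∈ s, y < x) ∧ ∀ y ∈ t, x < y := by
  induction ρ with
  | nil => exact ⟨[], [], by simp⟩
  | cons z ρ ih =>
    simp only [List.mem_cons, not_or] at hx
    obtain ⟨s, t, rfl, hs, ht⟩ := ih hx.2 (h.of_sublist ((List.sublist_cons_self _ _).cons_cons _))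
    rcases lt_or_gt_of_ne hx.1 with hz | hz
    · refine ⟨[], z :: (s ++ t), rfl, by simp, fun y hy => ?_⟩
      rcases List.mem_cons.1 hy with rfl | hy
      · exact hz
      by_contra hlt
      refine h (contains_231_iff.2 ⟨x, z, y, ?_, ?_, hz⟩)
      · exact ((List.singleton_sublist.2 hy).cons_cons z).cons_cons x
      · have : x ≠ y := fun e => hx.2 (e ▸ hy)
        omega
    · exact ⟨z :: s, t, rfl, by simpa using ⟨hz, hs⟩, ht⟩

theorem exists_eq_blockPerm {k n : ℕ} {π : List ℕ} (hπ : π.Perm (List.range' k n))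
    (h₁ : Avoids π [2, 3, 1]) (h₂ : Avoids π [4, 2, 1, 3]) :
    ∃ l, IsBlockList n l ∧ π = blockPerm k l := by
  induction n using Nat.strong_induction_on generalizing k π with
  | _ n ih =>
    cases π with
    | nil => exact ⟨[], by simpa [IsBlockList] using hπ.length_eq, rfl⟩
    | cons x ρ =>
      obtain ⟨hnd, hmem⟩ := perm_range'_iff.1 hπ
      obtain ⟨s, t, rfl, hs, ht⟩ := exists_split_of_avoids_231 (List.nodup_cons.1 hnd).1 h₁
      obtain ⟨r, rfl⟩ := Nat.exists_eq_add_of_le ((hmem x).1 (by simp)).1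
      have hr := (hmem (k + r)).1 (by simp)
      obtain ⟨m, rfl⟩ := Nat.exists_eq_add_of_le (show r + 1 ≤ n by omega)
      rw [← List.cons_append] at hnd hmem h₁ h₂ ⊢
      have hblock : (((k + r) :: s).Perm (List.range' k (r + 1))) := by
        refine perm_range'_iff.2 ⟨hnd.of_append_left, fun y => ?_⟩
        have := hmem y
        have hsy := hs y
        have hty := ht y
        simp only [List.mem_append, List.mem_cons] at this ⊢
        grind
      have hrest : t.Perm (List.range' (k + (r + 1)) m) := by
        refine perm_range'_iff.2 ⟨hnd.of_append_right, fun y => ?_⟩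
        have := hmem y
        have hsy := hs y
        have hty := ht y
        simp only [List.mem_append, List.mem_cons] at this
        grind
      obtain ⟨v, hvl, hv⟩ := exists_eq_extremalList hblock fun a b c habc => by
        refine ⟨fun h => h₁ (contains_231_iff.2
          ⟨a, b, c, habc.trans (List.sublist_append_left _ _), h⟩), fun h => ?_⟩
        rcases List.cons_sublist_cons'.1 habc with habc | ⟨rfl, hbc⟩
        · exact h₂ (contains_4213_iff.2 ⟨k + r, a, b, c,
            (habc.cons_cons _).trans (List.sublist_append_left _ _), h.1, h.2,
            hs c (habc.subset (by simp))⟩)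
        · have := hs c (hbc.subset (by simp))
          omega
      obtain ⟨l, hl, rfl⟩ := ih m (by omega) hrest
        (h₁.of_sublist (List.sublist_append_right _ _))
        (h₂.of_sublist (List.sublist_append_right _ _))
      refine ⟨v :: l, isBlockList_cons.2 ⟨?_, m, hl, by rw [hvl]⟩, by rw [hv, blockPerm, hvl]⟩
      match v with
      | [] => simp
      | true :: v => simp
      | false :: v =>
        have := (List.cons.inj hv).1
        simp at hvl
        omega

/-- The steps encoded by a word: `true` is an up step, `false` a horizontal step. -/
def wordSteps (v : List Bool) : List ℤ := v.map fun b => if b then 1 else 0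

/-- The steps of `v`, a horizontal step, and the descent from the height then reached to `0`,
starting at height `h`. -/
def blockSteps (h : ℕ) (v : List Bool) : List ℤ :=
  wordSteps v ++ 0 :: List.replicate (h + v.count true) (-1)

/-- The Motzkin path that concatenates the paths of the blocks. -/
def blockPath (l : List (List Bool)) : List ℤ := l.flatMap (blockSteps 0)

theorem blockSteps_nil (h : ℕ) : blockSteps h [] = 0 :: List.replicate h (-1) := by
  simp [blockSteps, wordSteps]

theorem blockSteps_true_cons (h : ℕ) (v : List Bool) :
    blockSteps h (true :: v) = 1 :: blockSteps (h + 1) v := by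
  simp [blockSteps, wordSteps, add_assoc, add_comm 1]

theorem blockSteps_false_cons (h : ℕ) (v : List Bool) :
    blockSteps h (false :: v) = 0 :: blockSteps h v := by
  simp [blockSteps, wordSteps]

theorem blockPath_cons (v : List Bool) (l : List (List Bool)) :
    blockPath (v :: l) = blockSteps 0 v ++ blockPath l := rfl

theorem head_blockSteps_append_ne (h : ℕ) (v : List Bool) (q : List ℤ) :
    (blockSteps h v ++ q).head? ≠ some (-1) := by
  rcases v with _ | ⟨_ | _, v⟩ <;>
    simp [blockSteps_nil, blockSteps_true_cons, blockSteps_false_cons]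

theorem blockSteps_append_inj {h : ℕ} (hh : 0 < h) {v v' : List Bool} {q q' : List ℤ}
    (e : blockSteps h v ++ q = blockSteps h v' ++ q') : v = v' ∧ q = q' := by
  have hrep : ∀ (v : List Bool) (q q' : List ℤ),
      List.replicate h (-1) ++ q ≠ blockSteps h v ++ q' := fun v q q' e => by
    obtain ⟨m, rfl⟩ := Nat.exists_eq_add_of_lt hh
    exact head_blockSteps_append_ne _ v q' (by rw [← e]; simp [List.replicate_succ])
  induction v generalizing h v' with
  | nil =>
    rcases v' with _ | ⟨_ | _, v'⟩
    · simpa using e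
    · simp only [blockSteps_nil, blockSteps_false_cons, List.cons_append] at e
      exact absurd (List.cons.inj e).2 (hrep _ _ _)
    · simp [blockSteps_nil, blockSteps_true_cons] at e
  | cons b v ih =>
    rcases b with _ | _ <;> rcases v' with _ | ⟨_ | _, v'⟩ <;>
      simp only [blockSteps_nil, blockSteps_true_cons, blockSteps_false_cons, List.cons_append,
        List.cons.injEq, zero_ne_one, one_ne_zero, true_and, false_and] at e
    · exact absurd e.symm (hrep _ _ _)
    · obtain ⟨rfl, rfl⟩ := ih hh e hrep
      exact ⟨rfl, rfl⟩
    · obtain ⟨rfl, rfl⟩ := ih (Nat.succ_pos h) e fun v q q' e =>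
        head_blockSteps_append_ne _ v q' (by rw [← e]; simp [List.replicate_succ])
      exact ⟨rfl, rfl⟩

theorem blockPath_injOn {n n' : ℕ} {l l' : List (List Bool)} (hl : IsBlockList n l)
    (hl' : IsBlockList n' l') (h : blockPath l = blockPath l') : l = l' := by
  induction l generalizing n n' l' with
  | nil =>
    cases l' with
    | nil => rfl
    | cons v' l' => simp [blockPath, blockSteps] at h
  | cons v l ih =>
    cases l' with
    | nil => simp [blockPath, blockSteps] at h
    | cons v' l' =>
      obtain ⟨hv, m, hm, -⟩ := isBlockList_cons.1 hl
      obtain ⟨hv', m', hm', -⟩ := isBlockList_cons.1 hl'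
      rw [blockPath_cons, blockPath_cons] at h
      rcases v with _ | ⟨_ | _, v⟩ <;> rcases v' with _ | ⟨_ | _, v'⟩ <;>
        simp only [blockSteps_nil, blockSteps_true_cons, List.cons_append, List.head?_cons,
          List.cons.injEq, zero_ne_one, one_ne_zero, true_and, false_and, ne_eq,
          not_true_eq_false] at h hv hv'
      · rw [ih hm hm' (by simpa using h)]
      · obtain ⟨rfl, e⟩ := blockSteps_append_inj Nat.one_pos h
        rw [ih hm hm' e]

/-- The paths from height `h` to the axis without peaks all of whose maximal descents end at
height `0`, described step by step. -/
inductive IsPathFrom : ℕ → List ℤ → Prop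
  | nil : IsPathFrom 0 []
  | up {h : ℕ} {p : List ℤ} (hd : p.head? ≠ some (-1)) (hp : IsPathFrom (h + 1) p) :
      IsPathFrom h (1 :: p)
  | flat {h : ℕ} {p : List ℤ} (hp : IsPathFrom h p) : IsPathFrom h (0 :: p)
  | down {h : ℕ} {p : List ℤ} (hd : p.head? ≠ some (-1) → h = 0) (hp : IsPathFrom h p) :
      IsPathFrom (h + 1) (-1 :: p)

theorem partialSums_nonneg_cons {h s : ℤ} {p : List ℤ} :
    (∀ i ≤ (s :: p).length, 0 ≤ h + ((s :: p).take i).sum) ↔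
      0 ≤ h ∧ ∀ i ≤ p.length, 0 ≤ h + s + (p.take i).sum := by
  constructor
  · intro H
    refine ⟨by simpa using H 0, fun i hi => ?_⟩
    simpa [add_assoc] using H (i + 1) (by simpa using hi)
  · rintro ⟨h0, H⟩ (_ | i) hi
    · simpa using h0
    · simpa [add_assoc] using H i (by simpa using hi)

theorem noPeak_cons {s : ℤ} {p : List ℤ} :
    NoPeak (s :: p) ↔ (s = 1 → p.head? ≠ some (-1)) ∧ NoPeak p := by
  constructor
  · intro H
    refine ⟨fun hs hp => ?_, fun i hi => ?_⟩
    · cases p with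
      | nil => simp at hp
      | cons t p => exact H 0 (by simp) (by simpa [hs] using hp)
    · simpa using H (i + 1) (by simpa using hi)
  · rintro ⟨h0, H⟩ (_ | i) hi
    · cases p with
      | nil => simp at hi
      | cons t p => simpa using h0
    · simpa using H i (by simpa using hi)

theorem downRuns_cons {h s : ℤ} {p : List ℤ} :
    (∀ i < (s :: p).length, (s :: p)[i]! = -1 →
        (i + 1 = (s :: p).length ∨ (s :: p)[i + 1]! ≠ -1) →
        h + ((s :: p).take (i + 1)).sum = 0) ↔
      (s = -1 → p.head? ≠ some (-1) → h + s = 0) ∧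
        ∀ i < p.length, p[i]! = -1 → (i + 1 = p.length ∨ p[i + 1]! ≠ -1) →
          h + s + (p.take (i + 1)).sum = 0 := by
  have hz : (1 = (s :: p).length ∨ (s :: p)[0 + 1]! ≠ -1) ↔ p.head? ≠ some (-1) := by
    cases p <;> simp
  constructor
  · intro H
    refine ⟨fun hs hp => ?_, fun i hi hi' hd => ?_⟩
    · simpa using H 0 (by simp) (by simpa using hs) (hz.2 hp)
    · simpa [add_assoc] using H (i + 1) (by simpa using hi) (by simpa using hi') (by simpa using hd)
  · rintro ⟨h0, H⟩ (_ | i) hi hi' hd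
    · simpa using h0 (by simpa using hi') (hz.1 hd)
    · simpa [add_assoc] using H i (by simpa using hi) (by simpa using hi') (by simpa using hd)

theorem isPathFrom_iff {h : ℕ} {p : List ℤ} :
    IsPathFrom h p ↔
      (∀ s ∈ p, s = 1 ∨ s = 0 ∨ s = -1) ∧
      (∀ i ≤ p.length, 0 ≤ (h : ℤ) + (p.take i).sum) ∧
      (h : ℤ) + p.sum = 0 ∧ NoPeak p ∧
      ∀ i < p.length, p[i]! = -1 → (i + 1 = p.length ∨ p[i + 1]! ≠ -1) →
        (h : ℤ) + (p.take (i + 1)).sum = 0 := by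
  induction p generalizing h with
  | nil =>
    constructor
    · rintro ⟨⟩
      simp [NoPeak]
    · rintro ⟨-, -, hs, -⟩
      obtain rfl : h = 0 := by simpa using hs
      exact .nil
  | cons s p ih =>
    rw [List.forall_mem_cons, partialSums_nonneg_cons, noPeak_cons, downRuns_cons,
      List.sum_cons, ← add_assoc]
    constructor
    · rintro (_ | ⟨hd, hp⟩ | hp | ⟨hd, hp⟩)
      · have := ih.1 hp
        push_cast at this
        simp_all
      · have := ih.1 hp
        simp_all
      · have := ih.1 hp
        push_cast
        simp_all
        omega
    · rintro ⟨⟨rfl | rfl | rfl, h₁⟩, ⟨-, h₂⟩, h₃, ⟨h₄, h₄'⟩, h₅, h₅'⟩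
      · exact .up (h₄ rfl) (ih.2 (by push_cast; exact ⟨h₁, h₂, h₃, h₄', h₅'⟩))
      · exact .flat (ih.2 (by simp only [add_zero] at h₂ h₃ h₅'; exact ⟨h₁, h₂, h₃, h₄', h₅'⟩))
      · have hpos := h₂ 0 (Nat.zero_le _)
        simp only [List.take_zero, List.sum_nil] at hpos
        obtain ⟨m, rfl⟩ : ∃ m, h = m + 1 := ⟨h - 1, by omega⟩
        have e : ((m + 1 : ℕ) : ℤ) + -1 = m := by push_cast; ring
        rw [e] at h₃ h₅
        simp only [e] at h₂ h₅'
        exact .down (fun hd => by simpa using h₅ rfl hd) (ih.2 ⟨h₁, h₂, h₃, h₄', h₅'⟩)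

theorem isPathFrom_zero_iff {p : List ℤ} :
    IsPathFrom 0 p ↔ IsMotzkin p ∧ NoPeak p ∧ DownRunsReachBottom p := by
  rw [isPathFrom_iff]
  simp only [Nat.cast_zero, zero_add, IsMotzkin, DownRunsReachBottom]
  tauto

theorem IsPathFrom.replicate_append {q : List ℤ} (hq : IsPathFrom 0 q) (h : ℕ) :
    IsPathFrom h (List.replicate h (-1) ++ q) := by
  induction h with
  | zero => simpa using hq
  | succ h ih =>
    refine .down (fun hd => ?_) ih
    cases h with
    | zero => rfl
    | succ h => simp [List.replicate_succ] at hd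

theorem IsPathFrom.blockSteps_append {q : List ℤ} (hq : IsPathFrom 0 q) (h : ℕ)
    (v : List Bool) : IsPathFrom h (blockSteps h v ++ q) := by
  induction v generalizing h with
  | nil => rw [blockSteps_nil]; exact .flat (hq.replicate_append h)
  | cons b v ih =>
    cases b
    · rw [blockSteps_false_cons]; exact .flat (ih h)
    · rw [blockSteps_true_cons]; exact .up (head_blockSteps_append_ne _ _ _) (ih (h + 1))

theorem isPathFrom_blockPath (l : List (List Bool)) : IsPathFrom 0 (blockPath l) := by
  induction l with
  | nil => exact .nil
  | cons v l ih => exact ih.blockSteps_append 0 v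

theorem upHorizCount_blockPath {n : ℕ} {l : List (List Bool)} (hl : IsBlockList n l) :
    upHorizCount (blockPath l) = n := by
  have hblock : ∀ v h, upHorizCount (blockSteps h v) = v.length + 1 := by
    intro v
    induction v with
    | nil => intro h; simp [blockSteps_nil, upHorizCount, List.countP_replicate]
    | cons b v ih =>
      intro h
      cases b
      · simpa [blockSteps_false_cons, upHorizCount] using ih h
      · rw [blockSteps_true_cons]
        simpa [upHorizCount, show (1 : ℤ) ≠ -1 by decide] using ih (h + 1)
  induction l generalizing n with
  | nil => obtain ⟨-, rfl⟩ := hl; rfl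
  | cons v l ih =>
    obtain ⟨-, m, hm, rfl⟩ := isBlockList_cons.1 hl
    rw [blockPath_cons, ← ih hm, ← hblock v 0]
    simp [upHorizCount]

theorem IsPathFrom.exists_replicate_append {h : ℕ} {p : List ℤ} (hp : IsPathFrom h p)
    (hd : p.head? = some (-1)) : ∃ q, p = List.replicate h (-1) ++ q ∧ IsPathFrom 0 q := by
  induction hp with
  | nil => simp at hd
  | up => simp at hd
  | flat => simp at hd
  | @down h p hd' hp ih =>
    by_cases hp' : p.head? = some (-1)
    · obtain ⟨q, rfl, hq⟩ := ih hp'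
      exact ⟨q, by simp [List.replicate_succ], hq⟩
    · obtain rfl := hd' hp'
      exact ⟨p, rfl, hp⟩

theorem IsPathFrom.exists_blockSteps_append {h : ℕ} {p : List ℤ} (hp : IsPathFrom (h + 1) p)
    (hd : p.head? ≠ some (-1)) :
    ∃ v q, p = blockSteps (h + 1) v ++ q ∧ IsPathFrom 0 q := by
  induction p generalizing h with
  | nil => cases hp
  | cons s p ih =>
    cases hp with
    | up hd' hp =>
      obtain ⟨v, q, rfl, hq⟩ := ih hp hd'
      exact ⟨true :: v, q, by rw [blockSteps_true_cons]; rfl, hq⟩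
    | flat hp =>
      by_cases hd' : p.head? = some (-1)
      · obtain ⟨q, rfl, hq⟩ := hp.exists_replicate_append hd'
        exact ⟨[], q, by rw [blockSteps_nil]; rfl, hq⟩
      · obtain ⟨v, q, rfl, hq⟩ := ih hp hd'
        exact ⟨false :: v, q, by rw [blockSteps_false_cons]; rfl, hq⟩
    | down => simp at hd

theorem IsPathFrom.exists_eq_blockPath {p : List ℤ} (hp : IsPathFrom 0 p) :
    ∃ l, (∀ v ∈ l, v.head? ≠ some false) ∧ p = blockPath l := by
  induction hlen : p.length using Nat.strong_induction_on generalizing p with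
  | _ m ih =>
    cases hp with
    | nil => exact ⟨[], by simp, rfl⟩
    | flat hp =>
      obtain ⟨l, hl, rfl⟩ := ih _ (by simp [← hlen]) hp rfl
      exact ⟨[] :: l, by simpa using hl, by rw [blockPath_cons, blockSteps_nil]; rfl⟩
    | up hd hp =>
      obtain ⟨v, q, rfl, hq⟩ := hp.exists_blockSteps_append hd
      obtain ⟨l, hl, rfl⟩ := ih q.length (by simp [← hlen]) hq rfl
      exact ⟨(true :: v) :: l, by simpa using hl,
        by rw [blockPath_cons, blockSteps_true_cons]; rfl⟩

theorem psb_sortable_equiv_motzkin (n : ℕ) :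
    Nonempty
      ({π : List ℕ // IsPermList n π ∧ Avoids π [2, 3, 1] ∧ Avoids π [4, 2, 1, 3]} ≃
        {p : List ℤ // IsMotzkin p ∧ NoPeak p ∧ DownRunsReachBottom p ∧ upHorizCount p = n}) := by
  let toPerm : {l // IsBlockList n l} →
      {π : List ℕ // IsPermList n π ∧ Avoids π [2, 3, 1] ∧ Avoids π [4, 2, 1, 3]} := fun l =>
    ⟨blockPerm 1 l.1, blockPerm_perm l.2, avoids_231_blockPerm 1 l.1, avoids_4213_blockPerm 1 l.1⟩
  let toPath : {l // IsBlockList n l} →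
      {p : List ℤ // IsMotzkin p ∧ NoPeak p ∧ DownRunsReachBottom p ∧ upHorizCount p = n} :=
    fun l =>
      have hp := isPathFrom_zero_iff.1 (isPathFrom_blockPath l.1)
      ⟨blockPath l.1, hp.1, hp.2.1, hp.2.2, upHorizCount_blockPath l.2⟩
  have toPerm_bijective : Function.Bijective toPerm := by
    refine ⟨fun l l' h => Subtype.ext (blockPerm_injOn l.2 l'.2 (congrArg Subtype.val h)), ?_⟩
    rintro ⟨π, hπ, h₁, h₂⟩
    obtain ⟨l, hl, rfl⟩ := exists_eq_blockPerm hπ h₁ h₂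
    exact ⟨⟨l, hl⟩, rfl⟩
  have toPath_bijective : Function.Bijective toPath := by
    refine ⟨fun l l' h => Subtype.ext (blockPath_injOn l.2 l'.2 (congrArg Subtype.val h)), ?_⟩
    rintro ⟨p, h₁, h₂, h₃, hn⟩
    obtain ⟨l, hl, rfl⟩ := (isPathFrom_zero_iff.2 ⟨h₁, h₂, h₃⟩).exists_eq_blockPath
    have hl' : IsBlockList _ l := ⟨hl, rfl⟩
    rw [upHorizCount_blockPath hl'] at hn
    exact ⟨⟨l, hn ▸ hl'⟩, rfl⟩
  exact ⟨(Equiv.ofBijective toPerm toPerm_bijective).symm.trans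
    (Equiv.ofBijective toPath toPath_bijective)⟩
end

section
/- Let PSB : S_n → S_n denote the map associated with the pop stack with bypass sorting algorithm. A permutation σ of size n has no preimage under PSB (i.e., PSB^{-1}(σ) = ∅) if and only if σ(n) ≠ n. Consequently, the number of permutations of size n with no preimage under PSB equals (n-1)·(n-1)!. -/
theorem psbAux_append_of_lt (p : List ℕ) {m : ℕ} :
    ∀ β : List ℕ, (∀ x ∈ β, x + 1 < m) → psbAux (β ++ p) [m] = β ++ psbAux p [m]
  | [], _ => rfl
  | x :: β, h => by
    have hx : x + 1 < m := h x (by simp)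
    have ih := psbAux_append_of_lt p β fun y hy => h y (by simp [hy])
    simp [psbAux, hx, hx.ne, ih]

theorem psbAux_cons_append_of_lt (p : List ℕ) {a m : ℕ} {β : List ℕ} (ham : a < m)
    (hβ : ∀ x ∈ β, x < a) : psbAux (m :: (β ++ p)) [a] = a :: (β ++ psbAux p [m]) := by
  have h := psbAux_append_of_lt p (m := m) β fun x hx => by have := hβ x hx; omega
  have h₁ : m + 1 ≠ a := by omega
  have h₂ : ¬ m + 1 < a := by omega
  simp [psbAux, h, h₁, h₂]

theorem exists_perm_psbAux_eq {n : ℕ} (l : List ℕ) :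
    ∀ (a : ℕ) (β : List ℕ), (∀ x ∈ β, x < a) → (∀ x ∈ a :: l, x < n) → (a :: l).Nodup →
      ∃ p : List ℕ, p.Perm (β ++ l ++ [n]) ∧ psbAux p [a] = a :: (β ++ l ++ [n]) := by
  induction l with
  | nil =>
    intro a β hβ hn _
    refine ⟨n :: (β ++ []), ?_, ?_⟩
    · simpa using (List.perm_append_singleton n β).symm
    · rw [psbAux_cons_append_of_lt [] (hn a (by simp)) hβ]
      simp [psbAux]
  | cons x l ih =>
    intro a β hβ hn hd
    simp only [List.nodup_cons, List.mem_cons, not_or] at hd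
    rcases lt_or_gt_of_ne hd.1.1 with hax | hxa
    · obtain ⟨p, hp, he⟩ := ih x [] (by simp) (fun y hy => hn y (List.mem_cons_of_mem _ hy))
        (List.nodup_cons.2 hd.2)
      refine ⟨x :: (β ++ p), ?_, ?_⟩
      · have h : (x :: (β ++ p)).Perm (x :: (β ++ (l ++ [n]))) :=
          (hp.append_left β).cons x
        exact h.trans (by simpa using (List.perm_middle (a := x) (l₁ := β) (l₂ := l ++ [n])).symm)
      · rw [psbAux_cons_append_of_lt p hax hβ, he]
        simp
    · obtain ⟨p, hp, he⟩ := ih a (β ++ [x])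
        (fun y hy => by
          rcases List.mem_append.1 hy with h | h
          · exact hβ y h
          · rwa [List.mem_singleton.1 h])
        (fun y hy => hn y (by
          rcases List.mem_cons.1 hy with h | h <;> simp [h]))
        (List.nodup_cons.2 ⟨hd.1.2, hd.2.2⟩)
      exact ⟨p, by simpa using hp, by simpa using he⟩

theorem exists_getLast?_psbAux_max (xs : List ℕ) :
    ∀ t k : ℕ, (xs ++ List.range' t (k + 1)).Nodup →
      ∃ z, (psbAux xs (List.range' t (k + 1))).getLast? = some z ∧
        ∀ y ∈ xs ++ List.range' t (k + 1), y ≤ z := by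
  induction xs with
  | nil =>
    intro t k _
    refine ⟨t + k, by simp [psbAux, List.getLast?_range'], fun y hy => ?_⟩
    simp at hy
    omega
  | cons x xs ih =>
    intro t k hd
    rw [List.cons_append, List.nodup_cons] at hd
    obtain ⟨hx, hd⟩ := hd
    simp only [List.mem_append, List.mem_range'_1, not_or] at hx
    by_cases h₁ : x + 1 = t
    · subst h₁
      have hr : x :: List.range' (x + 1) (k + 1) = List.range' x (k + 1 + 1) := rfl
      have he : psbAux (x :: xs) (List.range' (x + 1) (k + 1)) =
          psbAux xs (List.range' x (k + 1 + 1)) := by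
        simp [psbAux, List.range'_succ]
      obtain ⟨z, hz, hm⟩ := ih x (k + 1) (by
        rw [← hr, List.nodup_middle, List.nodup_cons]
        exact ⟨by simp [hx.1], hd⟩)
      refine ⟨z, by rw [he, hz], fun y hy => hm y ?_⟩
      rw [← hr]
      simp only [List.mem_append, List.mem_cons] at hy ⊢
      tauto
    · by_cases h₂ : x + 1 < t
      · obtain ⟨z, hz, hm⟩ := ih t k hd
        refine ⟨z, ?_, ?_⟩
        · have he : psbAux (x :: xs) (List.range' t (k + 1)) =
              x :: psbAux xs (List.range' t (k + 1)) := by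
            simp [psbAux, List.range'_succ, h₁, h₂]
          rw [he, List.getLast?_cons, hz]
          rfl
        · intro y hy
          rcases List.mem_cons.1 hy with rfl | hy
          · have := hm t (by simp)
            omega
          · exact hm y hy
      · obtain ⟨z, hz, hm⟩ := ih x 0 (by
          simp only [zero_add, List.range'_one]
          rw [List.nodup_middle, List.append_nil, List.nodup_cons]
          exact ⟨hx.1, hd.of_append_left⟩)
        have hxz : x ≤ z := hm x (by simp)
        refine ⟨z, ?_, ?_⟩
        · have he : psbAux (x :: xs) (List.range' t (k + 1)) =
              List.range' t (k + 1) ++ psbAux xs (List.range' x (0 + 1)) := by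
            simp [psbAux, List.range'_succ, h₁, h₂]
          rw [he, List.getLast?_append, hz]
          rfl
        · intro y hy
          simp only [List.cons_append, List.mem_cons, List.mem_append, List.mem_range'_1] at hy
          rcases hy with rfl | hy | hy
          · exact hxz
          · exact hm y (by simp [hy])
          · omega

theorem IsPermList.nodup {n : ℕ} {π : List ℕ} (h : IsPermList n π) : π.Nodup :=
  h.nodup_iff.2 List.nodup_range'

theorem IsPermList.mem_iff {n : ℕ} {π : List ℕ} (h : IsPermList n π) {x : ℕ} :
    x ∈ π ↔ 1 ≤ x ∧ x ≤ n := by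
  rw [List.Perm.mem_iff h, List.mem_range'_1]
  omega

theorem isPermList_append_singleton {n : ℕ} {τ : List ℕ} :
    IsPermList (n + 1) (τ ++ [n + 1]) ↔ IsPermList n τ := by
  unfold IsPermList
  rw [List.range'_1_concat, add_comm 1 n, List.perm_append_right_iff]

theorem getLast?_psb {n : ℕ} (hn : 1 ≤ n) {π : List ℕ} (hπ : IsPermList n π)
    (hσ : IsPermList n (psb π)) : (psb π).getLast? = some n := by
  have hnπ : n ∈ π := hπ.mem_iff.2 ⟨hn, le_rfl⟩
  cases π with
  | nil => simp at hnπ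
  | cons x xs =>
    obtain ⟨z, hz, hm⟩ := exists_getLast?_psbAux_max xs x 0 (by
      simp only [zero_add, List.range'_one]
      rw [List.nodup_middle, List.append_nil]
      exact hπ.nodup)
    have hz' : (psb (x :: xs)).getLast? = some z := hz
    have h₁ : n ≤ z := hm n (by simpa [or_comm] using hnπ)
    have h₂ : z ≤ n := (hσ.mem_iff.1 (List.mem_of_getLast? hz')).2
    rw [hz', le_antisymm h₂ h₁]

theorem exists_psb_eq {n : ℕ} {σ : List ℕ} (hσ : IsPermList n σ)
    (hl : σ.getLast? = some n) : ∃ π, IsPermList n π ∧ psb π = σ := by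
  obtain ⟨τ, rfl⟩ := List.getLast?_eq_some_iff.1 hl
  cases τ with
  | nil => exact ⟨[n], hσ, rfl⟩
  | cons a l =>
    have hd := hσ.nodup
    rw [List.nodup_append] at hd
    obtain ⟨p, hp, he⟩ := exists_perm_psbAux_eq (n := n) l a [] (by simp)
      (fun x hx => lt_of_le_of_ne (hσ.mem_iff.1 (List.mem_append_left _ hx)).2
        (hd.2.2 x hx n (by simp))) hd.1
    refine ⟨a :: p, ?_, ?_⟩
    · exact List.Perm.trans (by simpa using hp) hσ
    · simpa [psb, psbAux] using he

theorem card_preimage_psb_eq_zero_iff {n : ℕ} (hn : 1 ≤ n) {σ : List ℕ} (hσ : IsPermList n σ) :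
    Nat.card {π : List ℕ // IsPermList n π ∧ psb π = σ} = 0 ↔ σ.getLast? ≠ some n := by
  have hfin : Finite {π : List ℕ // IsPermList n π ∧ psb π = σ} :=
    Set.Finite.to_subtype ((List.finite_toSet (List.range' 1 n).permutations).subset
      fun π hπ => List.mem_permutations.2 hπ.1)
  rw [Finite.card_eq_zero_iff, isEmpty_subtype]
  constructor
  · intro h hl
    obtain ⟨π, hπ⟩ := exists_psb_eq hσ hl
    exact h π hπ
  · rintro h π ⟨hπ, rfl⟩
    exact h (getLast?_psb hn hπ hσ)

/-- The finite set of permutations of `{1,…,n}`. -/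
def permLists (n : ℕ) : Finset (List ℕ) := (List.range' 1 n).permutations.toFinset

theorem mem_permLists {n : ℕ} {σ : List ℕ} : σ ∈ permLists n ↔ IsPermList n σ := by
  simp [permLists, IsPermList]

theorem card_permLists (n : ℕ) : (permLists n).card = n.factorial := by
  rw [permLists, List.toFinset_card_of_nodup (List.nodup_permutations _ List.nodup_range'),
    List.length_permutations, List.length_range']

theorem card_permLists_getLast?_eq (n : ℕ) :
    ((permLists (n + 1)).filter fun σ => σ.getLast? = some (n + 1)).card = n.factorial := by
  have h : ((permLists (n + 1)).filter fun σ => σ.getLast? = some (n + 1)) =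
      (permLists n).image (· ++ [n + 1]) := by
    ext σ
    simp only [Finset.mem_filter, Finset.mem_image, mem_permLists]
    constructor
    · rintro ⟨hσ, hl⟩
      obtain ⟨τ, rfl⟩ := List.getLast?_eq_some_iff.1 hl
      exact ⟨τ, isPermList_append_singleton.1 hσ, rfl⟩
    · rintro ⟨τ, hτ, rfl⟩
      exact ⟨isPermList_append_singleton.2 hτ, by simp⟩
  rw [h, Finset.card_image_of_injective _ (List.append_left_injective _), card_permLists]

theorem psb_no_preimage (n : ℕ) (hn : 1 ≤ n) :
    (∀ σ : List ℕ, IsPermList n σ →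
      (Nat.card {π : List ℕ // IsPermList n π ∧ psb π = σ} = 0 ↔ σ.getLast? ≠ some n)) ∧
    Nat.card {σ : List ℕ // IsPermList n σ ∧
        Nat.card {π : List ℕ // IsPermList n π ∧ psb π = σ} = 0}
      = (n - 1) * Nat.factorial (n - 1) := by
  refine ⟨fun σ hσ => card_preimage_psb_eq_zero_iff hn hσ, ?_⟩
  obtain ⟨m, rfl⟩ := Nat.exists_eq_add_of_le' hn
  rw [Nat.subtype_card ((permLists (m + 1)).filter fun σ => ¬ σ.getLast? = some (m + 1))]
  · have h := Finset.card_filter_add_card_filter_not (s := permLists (m + 1))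
      (fun σ => σ.getLast? = some (m + 1))
    rw [card_permLists_getLast?_eq, card_permLists, Nat.factorial_succ, add_mul, one_mul] at h
    rw [Nat.add_sub_cancel]
    omega
  · intro σ
    rw [Finset.mem_filter, mem_permLists]
    exact and_congr_right fun hσ => (card_preimage_psb_eq_zero_iff hn hσ).symm
end

section
/- For a permutation π of size n, Bubblesort(PSB(π)) = id_n if and only if π avoids all six patterns 2341, 3421, 3241, 25314, 52314, and 53214. -/
/-- The (optimal) Queuesort procedure, using a queue with a bypass; the second
argument is the queue, front-first. -/
def queuesortAux : List ℕ → List ℕ → List ℕ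
  | [], q => q
  | x :: xs, q =>
      match q.getLast? with
      | none => queuesortAux xs [x]
      | some b =>
          if b < x then queuesortAux xs (q ++ [x])
          else q.takeWhile (fun a => decide (a < x)) ++
            x :: queuesortAux xs (q.dropWhile (fun a => decide (a < x)))

/-- The map associated with Queuesort. -/
def queuesort (π : List ℕ) : List ℕ := queuesortAux π []

/-- One pass of Bubblesort: traverse left to right, swapping adjacent
out-of-order entries. -/
def bubblesort : List ℕ → List ℕ
  | [] => []
  | [x] => [x]
  | x :: y :: xs => if x ≤ y then x :: bubblesort (y :: xs) else y :: bubblesort (x :: xs)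

/-- The sublists of a duplicate-free list `l` are the lists of members of `l` whose positions
in `l` increase. -/
theorem List.Nodup.sublist_iff_pairwise_idxOf {l : List ℕ} (hl : l.Nodup) (τ : List ℕ) :
    τ.Sublist l ↔ (∀ x ∈ τ, x ∈ l) ∧ τ.Pairwise (fun x y => l.idxOf x < l.idxOf y) := by
  have hself : l.Pairwise (fun x y => l.idxOf x < l.idxOf y) := by
    rw [List.pairwise_iff_getElem]
    intro i j hi hj hij
    rwa [hl.idxOf_getElem, hl.idxOf_getElem]
  refine ⟨fun h => ⟨h.subset, hself.sublist h⟩, fun ⟨hmem, hpw⟩ => ?_⟩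
  have : Std.Antisymm (fun x y : ℕ => l.idxOf x < l.idxOf y) :=
    ⟨fun a b h h' => absurd h (by omega)⟩
  have hnd : τ.Nodup := hpw.imp (fun {a b} h => by rintro rfl; omega)
  exact List.sublist_of_subperm_of_pairwise (List.subperm_of_subset hnd hmem) hpw hself

theorem List.pair_sublist_append_iff {a c : ℕ} {l₁ l₂ : List ℕ} :
    [a, c].Sublist (l₁ ++ l₂) ↔
      [a, c].Sublist l₁ ∨ [a, c].Sublist l₂ ∨ (a ∈ l₁ ∧ c ∈ l₂) := by
  induction l₁ with
  | nil => simp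
  | cons x l₁ ih =>
    rw [List.cons_append, List.sublist_cons_iff, ih, List.sublist_cons_iff]
    simp only [List.cons.injEq, ↓existsAndEq, List.singleton_sublist, List.mem_append,
      List.mem_cons, and_true]
    grind

theorem bubblesort_perm (l : List ℕ) : (bubblesort l).Perm l := by
  induction l using bubblesort.induct with
  | case1 => simp [bubblesort]
  | case2 => simp [bubblesort]
  | case3 x y xs h ih => simpa [bubblesort, h] using ih
  | case4 x y xs h ih =>
    simp only [bubblesort, h, if_false]
    exact (ih.cons y).trans (List.Perm.swap x y xs)

/-- Bubblesort sorts exactly the lists in which no entry is preceded by two larger ones. -/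
theorem bubblesort_pairwise_iff (l : List ℕ) :
    (bubblesort l).Pairwise (· ≤ ·) ↔
      ∀ a b c, [a, b, c].Sublist l → a ≤ c ∨ b ≤ c := by
  induction l using bubblesort.induct with
  | case1 => simp [bubblesort]
  | case2 => simp [bubblesort, List.sublist_cons_iff]
  | case3 x y xs h ih =>
    simp only [bubblesort, h, if_true, List.pairwise_cons, ih, (bubblesort_perm _).mem_iff]
    constructor
    · rintro ⟨h1, h2⟩ a b c hs
      rcases List.sublist_cons_iff.1 hs with hs | ⟨r, hr, hs⟩
      · exact h2 a b c hs
      · obtain ⟨rfl, rfl⟩ := List.cons.inj hr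
        exact Or.inl (h1 c (hs.subset (by simp)))
    · refine fun H => ⟨fun c hc => ?_, fun a b c hs => H a b c (hs.cons x)⟩
      rcases List.mem_cons.1 hc with rfl | hc
      · exact h
      · have := H x y c (by simpa using hc)
        omega
  | case4 x y xs h ih =>
    simp only [bubblesort, h, if_false, List.pairwise_cons, ih, (bubblesort_perm _).mem_iff]
    constructor
    · rintro ⟨h1, h2⟩ a b c hs
      rcases List.sublist_cons_iff.1 hs with hs | ⟨r, hr, hs⟩
      · rcases List.sublist_cons_iff.1 hs with hs | ⟨r, hr, hs⟩
        · exact h2 a b c (hs.cons x)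
        · obtain ⟨rfl, rfl⟩ := List.cons.inj hr
          exact Or.inl (h1 c (List.mem_cons_of_mem _ (hs.subset (by simp))))
      · obtain ⟨rfl, rfl⟩ := List.cons.inj hr
        rcases List.sublist_cons_iff.1 hs with hs | ⟨r, hr, hs⟩
        · exact h2 a b c (hs.cons_cons a)
        · obtain ⟨rfl, rfl⟩ := List.cons.inj hr
          exact Or.inr (h1 c (List.mem_cons_of_mem _ (hs.subset (by simp))))
    · refine fun H => ⟨fun c hc => ?_, fun a b c hs => ?_⟩
      · rcases List.mem_cons.1 hc with rfl | hc
        · omega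
        · have := H x y c (by simpa using hc)
          omega
      · rcases List.sublist_cons_iff.1 hs with hs | ⟨r, hr, hs⟩
        · exact H a b c ((hs.cons y).cons x)
        · obtain ⟨rfl, rfl⟩ := List.cons.inj hr
          exact H a b c ((hs.cons y).cons_cons a)

theorem psbAux_perm (xs s : List ℕ) : (psbAux xs s).Perm (xs ++ s) := by
  induction xs, s using psbAux.induct with
  | case1 => simp [psbAux]
  | case2 x xs ih =>
    rw [psbAux]
    exact ih.trans (by simp)
  | case3 x xs s ih =>
    rw [psbAux, if_pos rfl]
    exact ih.trans List.perm_middle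
  | case4 x xs t s h h' ih =>
    rw [psbAux, if_neg h, if_pos h']
    exact ih.cons x
  | case5 x xs t s h h' ih =>
    rw [psbAux, if_neg h, if_neg h']
    exact (List.perm_append_comm.trans (ih.append_right _)).trans (by simp)

theorem psb_perm (π : List ℕ) : (psb π).Perm π :=
  (psbAux_perm π []).trans (by simp)

/-- The inversion `a > c` of `π` is still an inversion of `psb π`: either `a` leaves the stack
before `c` is read because of an intermediate larger entry, or `a` bypasses the stack. -/
def Survives (π : List ℕ) (a c : ℕ) : Prop :=
  π.idxOf a < π.idxOf c ∧
    ((∃ d ∈ π, a < d ∧ π.idxOf a < π.idxOf d ∧ π.idxOf d < π.idxOf c) ∨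
      (∃ b ∈ π, ∃ m ∈ π, a < b ∧ b < m ∧ π.idxOf b < π.idxOf m ∧ π.idxOf m < π.idxOf a) ∨
      (∃ b ∈ π, ∃ m ∈ π, a < b ∧ b < m ∧ π.idxOf m < π.idxOf a ∧ π.idxOf a < π.idxOf b))

/-- The state of the pop stack `t :: s` once the first `k` entries of `π` have been read. -/
structure StackInv (π : List ℕ) (k t : ℕ) (s : List ℕ) (M : ℕ) : Prop where
  inc : (t :: s).Pairwise (· < ·)
  mem_iff : ∀ v, v ∈ t :: s ↔ t ≤ v ∧ v ≤ M
  seen : ∀ v ∈ t :: s, v ∈ π ∧ π.idxOf v < k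
  le_max : ∀ v ∈ π, π.idxOf v < k → v ≤ M
  order : ∀ a ∈ t :: s, ∀ d ∈ π, π.idxOf a < π.idxOf d → π.idxOf d < k → d < a
  top : ∀ v ∈ π, v + 1 = t → π.idxOf v < k → π.idxOf v < π.idxOf t

theorem List.idxOf_inj_of_mem {π : List ℕ} {x y : ℕ} (hx : x ∈ π)
    (h : π.idxOf x = π.idxOf y) : x = y := (List.idxOf_inj hx).1 h

theorem StackInv.push {π : List ℕ} {k t : ℕ} {s : List ℕ} {M x : ℕ}
    (h : StackInv π k t s M) (hx : x ∈ π) (hk : π.idxOf x = k) (hxt : x + 1 = t) :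
    StackInv π (k + 1) x (t :: s) M := by
  obtain ⟨h1, h2, h3, h4, h5, h6⟩ := h
  have ht : t ≤ M := ((h2 t).1 (by simp)).2
  have inj : ∀ v ∈ π, π.idxOf v = k → v = x := fun v hv h =>
    List.idxOf_inj_of_mem hv (h.trans hk.symm)
  refine ⟨List.pairwise_cons.2 ⟨fun v hv => ?_, h1⟩, fun v => ?_, fun v hv => ?_,
    fun v hv hvk => ?_, fun a ha d hd hp hdk => ?_, fun v hv hvx hvk => ?_⟩
  · have := (h2 v).1 hv
    omega
  · rw [List.mem_cons, h2]
    omega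
  · rcases List.mem_cons.1 hv with rfl | hv
    · exact ⟨hx, by omega⟩
    · exact ⟨(h3 v hv).1, by have := (h3 v hv).2; omega⟩
  · rcases Nat.lt_succ_iff_lt_or_eq.1 hvk with hvk | hvk
    · exact h4 v hv hvk
    · have := inj v hv hvk
      omega
  · rcases Nat.lt_succ_iff_lt_or_eq.1 hdk with hdk | hdk
    · rcases List.mem_cons.1 ha with rfl | ha
      · omega
      · exact h5 a ha d hd hp hdk
    · have := inj d hd hdk
      rcases List.mem_cons.1 ha with rfl | ha
      · subst this; omega
      · have := (h2 a).1 ha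
        omega
  · rcases Nat.lt_succ_iff_lt_or_eq.1 hvk with hvk | hvk
    · omega
    · have := inj v hv hvk
      omega

theorem StackInv.bypass {π : List ℕ} {k t : ℕ} {s : List ℕ} {M x : ℕ}
    (h : StackInv π k t s M) (hk : π.idxOf x = k) (hxt : x + 1 < t) :
    StackInv π (k + 1) t s M := by
  obtain ⟨h1, h2, h3, h4, h5, h6⟩ := h
  have ht : t ≤ M := ((h2 t).1 (by simp)).2
  have inj : ∀ v ∈ π, π.idxOf v = k → v = x := fun v hv h =>
    List.idxOf_inj_of_mem hv (h.trans hk.symm)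
  refine ⟨h1, h2, fun v hv => ⟨(h3 v hv).1, by have := (h3 v hv).2; omega⟩,
    fun v hv hvk => ?_, fun a ha d hd hp hdk => ?_, fun v hv hvx hvk => ?_⟩
  · rcases Nat.lt_succ_iff_lt_or_eq.1 hvk with hvk | hvk
    · exact h4 v hv hvk
    · have := inj v hv hvk
      omega
  · rcases Nat.lt_succ_iff_lt_or_eq.1 hdk with hdk | hdk
    · exact h5 a ha d hd hp hdk
    · have := inj d hd hdk
      have := (h2 a).1 ha
      omega
  · rcases Nat.lt_succ_iff_lt_or_eq.1 hvk with hvk | hvk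
    · exact h6 v hv hvx hvk
    · have := inj v hv hvk
      omega

theorem StackInv.singleton {π : List ℕ} {k x : ℕ} (hx : x ∈ π) (hk : π.idxOf x = k)
    (hmax : ∀ v ∈ π, π.idxOf v < k → v ≤ x) : StackInv π (k + 1) x [] x := by
  have inj : ∀ v ∈ π, π.idxOf v = k → v = x := fun v hv h =>
    List.idxOf_inj_of_mem hv (h.trans hk.symm)
  refine ⟨by simp, fun v => by simp; omega, fun v hv => ?_,
    fun v hv hvk => ?_, fun a ha d hd hp hdk => ?_, fun v hv hvx hvk => ?_⟩
  · obtain rfl : v = x := by simpa using hv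
    exact ⟨hx, by omega⟩
  · rcases Nat.lt_succ_iff_lt_or_eq.1 hvk with hvk | hvk
    · exact hmax v hv hvk
    · exact (inj v hv hvk).le
  · obtain rfl : a = x := by simpa using ha
    omega
  · rcases Nat.lt_succ_iff_lt_or_eq.1 hvk with hvk | hvk
    · omega
    · have := inj v hv hvk
      omega

/-- An entry on the stack forms surviving inversions only with entries that come after the next
one to be read. -/
theorem StackInv.exists_of_survives {π : List ℕ} {k t : ℕ} {s : List ℕ} {M a c : ℕ}
    (h : StackInv π k t s M) (ha : a ∈ t :: s) (hs : Survives π a c) :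
    k < π.idxOf c := by
  obtain ⟨h1, h2, h3, h4, h5, h6⟩ := h
  have hat := (h2 a).1 ha
  have hak := (h3 a ha).2
  obtain ⟨-, ⟨d, hd, had, hp, hp'⟩ | ⟨b, hb, m, hm, hab, hbm, hp, hp'⟩ |
    ⟨b, hb, m, hm, hab, hbm, hp, hp'⟩⟩ := hs
  · by_contra hc
    have := h5 a ha d hd hp (by omega)
    omega
  · have hmM := h4 m hm (by omega)
    have := h5 b ((h2 b).2 (by omega)) m hm hp (by omega)
    omega
  · have hmM := h4 m hm (by omega)
    have hbk := (h3 b ((h2 b).2 (by omega))).2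
    have := h5 a ha b hb hp' hbk
    omega

theorem List.Nodup.mem_drop_iff {π : List ℕ} (hπ : π.Nodup) {k v : ℕ} :
    v ∈ π.drop k ↔ v ∈ π ∧ k ≤ π.idxOf v := by
  rw [List.mem_drop_iff_getElem]
  constructor
  · rintro ⟨i, hi, rfl⟩
    exact ⟨List.getElem_mem _, by rw [hπ.idxOf_getElem]; omega⟩
  · rintro ⟨hv, hk⟩
    have := List.idxOf_lt_length_of_mem hv
    exact ⟨π.idxOf v - k, by omega, by simp [Nat.add_sub_cancel' hk]⟩

/-- The inversions of the output of PSB started from an intermediate state. -/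
theorem pair_sublist_psbAux_iff {n : ℕ} {π : List ℕ} (hπ : IsPermList n π)
    (xs : List ℕ) : ∀ (k t : ℕ) (s : List ℕ) (M : ℕ), π.drop k = xs → StackInv π k t s M →
      ∀ a c, a ∈ t :: s ∨ a ∈ xs → c ∈ t :: s ∨ c ∈ xs → c < a →
        ([a, c].Sublist (psbAux xs (t :: s)) ↔ Survives π a c) := by
  have hnd : π.Nodup := hπ.symm.nodup (List.nodup_range' ..)
  have hmem : ∀ v, v ∈ π ↔ 1 ≤ v ∧ v ≤ n := fun v => by
    rw [List.Perm.mem_iff hπ, List.mem_range'_1]; omega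
  have not_stack : ∀ {k t : ℕ} {s : List ℕ} {M a c : ℕ}, StackInv π k t s M → c < a →
      ¬ [a, c].Sublist (t :: s) := fun h hca hs => by
    have := h.inc.sublist hs
    simp at this
    omega
  induction xs with
  | nil =>
    intro k t s M hxs hI a c ha hc hca
    rw [psbAux]
    refine iff_of_false (not_stack hI hca) fun hs => ?_
    have := hI.exists_of_survives (by simpa using ha) hs
    have := (hI.seen c (by simpa using hc)).2
    omega
  | cons x xs ih =>
    intro k t s M hxs hI a c ha hc hca
    have hxs' : π.drop (k + 1) = xs := by
      rw [← List.drop_drop, hxs, List.drop_succ_cons, List.drop_zero]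
    have hk : k < π.length := by
      by_contra hk
      rw [List.drop_of_length_le (by omega)] at hxs
      cases hxs
    rw [List.drop_eq_getElem_cons hk] at hxs
    have hxk : π[k] = x := (List.cons.inj hxs).1
    have hx : x ∈ π := hxk ▸ List.getElem_mem _
    have hidx : π.idxOf x = k := by rw [← hxk, hnd.idxOf_getElem]
    have hlater : ∀ v ∈ xs, v ∈ π ∧ k < π.idxOf v := fun v hv =>
      hnd.mem_drop_iff.1 (hxs' ▸ hv)
    have hxs_mem : ∀ {v}, v ∈ psbAux xs (t :: s) ↔ v ∈ xs ∨ v ∈ t :: s := by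
      intro v; rw [(psbAux_perm _ _).mem_iff, List.mem_append]
    have hx_mem : ∀ {v}, v ∈ psbAux xs [x] ↔ v ∈ xs ∨ v = x := by
      intro v; rw [(psbAux_perm _ _).mem_iff, List.mem_append, List.mem_singleton]
    rw [psbAux]
    split_ifs with hpush hby
    · refine ih (k + 1) x (t :: s) M hxs' (hI.push hx hidx hpush) a c ?_ ?_ hca
      · simp only [List.mem_cons] at ha ⊢; tauto
      · simp only [List.mem_cons] at hc ⊢; tauto
    · have hI' := hI.bypass hidx hby
      have hx_notin : x ∉ psbAux xs (t :: s) := fun h => by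
        rcases hxs_mem.1 h with h | h
        · have := (hlater x h).2; omega
        · have := (hI.mem_iff x).1 h; omega
      rw [List.sublist_cons_iff]
      simp only [List.cons.injEq, ↓existsAndEq, List.singleton_sublist, and_true]
      by_cases hax : a = x
      · subst hax
        have hcxs : c ∈ xs := by
          rcases hc with hc | hc
          · have := (hI.mem_iff c).1 hc; omega
          · rcases List.mem_cons.1 hc with rfl | hc
            · omega
            · exact hc
        refine iff_of_true (Or.inr ⟨rfl, hxs_mem.2 (Or.inl hcxs)⟩)
          ⟨by have := (hlater c hcxs).2; omega, Or.inr ?_⟩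
        have ht := hI.seen t (by simp)
        have htn := (hmem t).1 ht.1
        have ha1 := (hmem a).1 hx
        have hb : t - 1 ∈ π := (hmem _).2 (by omega)
        rcases lt_trichotomy (π.idxOf (t - 1)) k with hlt | heq | hgt
        · exact Or.inl ⟨t - 1, hb, t, ht.1, by omega, by omega,
            hI.top _ hb (by omega) hlt, by omega⟩
        · have := List.idxOf_inj_of_mem hb (heq.trans hidx.symm)
          omega
        · exact Or.inr ⟨t - 1, hb, t, ht.1, by omega, by omega, by omega, by omega⟩
      · have ha' : a ∈ t :: s ∨ a ∈ xs := ha.imp_right fun h => by simpa [hax] using h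
        by_cases hcx : c = x
        · subst hcx
          refine iff_of_false ?_ fun hs => ?_
          · rintro (h | ⟨h, -⟩)
            · exact hx_notin (h.subset (by simp))
            · exact hax h
          · rcases ha' with ha' | ha'
            · have := hI.exists_of_survives ha' hs
              omega
            · have := (hlater a ha').2
              have := hs.1
              omega
        · have hc' : c ∈ t :: s ∨ c ∈ xs := hc.imp_right fun h => by simpa [hcx] using h
          rw [← ih (k + 1) t s M hxs' hI' a c ha' hc' hca]
          simp [hax]
    · have hMx : M < x := by
        by_contra hle
        have hxt : x ≠ t := fun h => by
          have := (hI.seen t (by simp)).2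
          rw [← h] at this
          omega
        have := (hI.seen x ((hI.mem_iff x).2 (by omega))).2
        omega
      have hI' := StackInv.singleton hx hidx fun v hv hvk => (hI.le_max v hv hvk).trans hMx.le
      rw [List.pair_sublist_append_iff]
      by_cases has : a ∈ t :: s
      · have haM := (hI.mem_iff a).1 has
        have hak := (hI.seen a has).2
        have ha_notin : a ∉ psbAux xs [x] := fun h => by
          rcases hx_mem.1 h with h | h
          · have := (hlater a h).2; omega
          · omega
        by_cases hcs : c ∈ t :: s
        · have hck := (hI.seen c hcs).2
          refine iff_of_false ?_ fun hs => ?_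
          · rintro (h | h | ⟨-, h⟩)
            · exact not_stack hI hca h
            · exact ha_notin (h.subset (by simp))
            · rcases hx_mem.1 h with h | h
              · have := (hlater c h).2; omega
              · omega
          · have := hI.exists_of_survives has hs
            omega
        · have hcxs : c ∈ xs := by
            rcases List.mem_cons.1 (hc.resolve_left hcs) with rfl | hc
            · omega
            · exact hc
          have hck := (hlater c hcxs).2
          exact iff_of_true (Or.inr (Or.inr ⟨has, hx_mem.2 (Or.inl hcxs)⟩))
            ⟨by omega, Or.inl ⟨x, hx, by omega, by omega, by omega⟩⟩
      · have ha' := ha.resolve_left has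
        have hak : k ≤ π.idxOf a := by
          rcases List.mem_cons.1 ha' with rfl | h
          · omega
          · exact (hlater a h).2.le
        have h1 : ¬ [a, c].Sublist (t :: s) := not_stack hI hca
        by_cases hcs : c ∈ t :: s
        · have hck := (hI.seen c hcs).2
          refine iff_of_false ?_ fun hs => ?_
          · rintro (h | h | ⟨h, -⟩)
            · exact h1 h
            · rcases hx_mem.1 (h.subset (by simp : c ∈ [a, c])) with h | h
              · have := (hlater c h).2; omega
              · subst h; omega
            · exact has h
          · have := hs.1
            omega
        · have hc' := hc.resolve_left hcs
          rw [← ih (k + 1) x [] x hxs' hI' a c (by simpa using ha') (by simpa using hc') hca]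
          tauto

theorem pair_sublist_psb_iff {n : ℕ} {π : List ℕ} (hπ : IsPermList n π) {a c : ℕ}
    (ha : a ∈ π) (hc : c ∈ π) (hca : c < a) :
    [a, c].Sublist (psb π) ↔ Survives π a c := by
  cases π with
  | nil => simp at ha
  | cons x xs =>
    have hI : StackInv (x :: xs) 1 x [] x :=
      StackInv.singleton (by simp) (by simp) (by simp)
    exact pair_sublist_psbAux_iff hπ xs 1 x [] x rfl hI a c (by simpa using ha)
      (by simpa using hc) hca

theorem exists_inversions_psb_iff {n : ℕ} {π : List ℕ} (hπ : IsPermList n π) :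
    (∃ a b c, [a, b, c].Sublist (psb π) ∧ c < a ∧ c < b) ↔
      ∃ a ∈ π, ∃ b ∈ π, ∃ c ∈ π, c < a ∧ a < b ∧ Survives π a c ∧ Survives π b c := by
  have hnd : π.Nodup := hπ.symm.nodup (List.nodup_range' ..)
  have hperm := psb_perm π
  have hnd' : (psb π).Nodup := hperm.symm.nodup hnd
  constructor
  · rintro ⟨a, b, c, hs, hca, hcb⟩
    have ha := hperm.subset (hs.subset (by simp : a ∈ [a, b, c]))
    have hb := hperm.subset (hs.subset (by simp : b ∈ [a, b, c]))
    have hc := hperm.subset (hs.subset (by simp : c ∈ [a, b, c]))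
    have hac := (pair_sublist_psb_iff hπ ha hc hca).1 (.trans (by simp) hs)
    have hbc := (pair_sublist_psb_iff hπ hb hc hcb).1 (.trans (by simp) hs)
    have hab : a ≠ b := by
      have := hnd'.sublist hs
      simp at this
      tauto
    rcases hab.lt_or_gt with h | h
    · exact ⟨a, ha, b, hb, c, hc, hca, h, hac, hbc⟩
    · exact ⟨b, hb, a, ha, c, hc, hcb, h, hbc, hac⟩
  · rintro ⟨a, ha, b, hb, c, hc, hca, hab, hac, hbc⟩
    have h1 := (pair_sublist_psb_iff hπ ha hc hca).2 hac
    have h2 := (pair_sublist_psb_iff hπ hb hc (hca.trans hab)).2 hbc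
    rw [hnd'.sublist_iff_pairwise_idxOf] at h1 h2
    simp at h1 h2
    rcases lt_trichotomy ((psb π).idxOf a) ((psb π).idxOf b) with h | h | h
    · exact ⟨a, b, c, by rw [hnd'.sublist_iff_pairwise_idxOf]; simp [h, h1, h2], hca, by omega⟩
    · have := List.idxOf_inj_of_mem h1.1.1 h
      omega
    · exact ⟨b, a, c, by rw [hnd'.sublist_iff_pairwise_idxOf]; simp [h, h1, h2], by omega, hca⟩

theorem contains_four_iff {π : List ℕ} {s₀ s₁ s₂ s₃ : ℕ} :
    Contains π [s₀, s₁, s₂, s₃] ↔ ∃ x₀ x₁ x₂ x₃, [x₀, x₁, x₂, x₃].Sublist π ∧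
      ∀ i < 4, ∀ j < 4, ([x₀, x₁, x₂, x₃][i]! < [x₀, x₁, x₂, x₃][j]! ↔
        [s₀, s₁, s₂, s₃][i]! < [s₀, s₁, s₂, s₃][j]!) := by
  constructor
  · rintro ⟨τ, hτ, hlen, h⟩
    match τ, hlen with
    | [x₀, x₁, x₂, x₃], _ => exact ⟨x₀, x₁, x₂, x₃, hτ, fun i hi j hj => h i j hi hj⟩
  · rintro ⟨x₀, x₁, x₂, x₃, hτ, h⟩
    exact ⟨[x₀, x₁, x₂, x₃], hτ, rfl, fun i j hi hj => h i hi j hj⟩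

theorem contains_five_iff {π : List ℕ} {s₀ s₁ s₂ s₃ s₄ : ℕ} :
    Contains π [s₀, s₁, s₂, s₃, s₄] ↔ ∃ x₀ x₁ x₂ x₃ x₄, [x₀, x₁, x₂, x₃, x₄].Sublist π ∧
      ∀ i < 5, ∀ j < 5, ([x₀, x₁, x₂, x₃, x₄][i]! < [x₀, x₁, x₂, x₃, x₄][j]! ↔
        [s₀, s₁, s₂, s₃, s₄][i]! < [s₀, s₁, s₂, s₃, s₄][j]!) := by
  constructor
  · rintro ⟨τ, hτ, hlen, h⟩
    match τ, hlen with
    | [x₀, x₁, x₂, x₃, x₄], _ => exact ⟨x₀, x₁, x₂, x₃, x₄, hτ, fun i hi j hj => h i j hi hj⟩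
  · rintro ⟨x₀, x₁, x₂, x₃, x₄, hτ, h⟩
    exact ⟨[x₀, x₁, x₂, x₃, x₄], hτ, rfl, fun i j hi hj => h i hi j hj⟩

theorem contains_2341_iff {π : List ℕ} : Contains π [2, 3, 4, 1] ↔
    ∃ x₂ x₃ x₄ x₁, [x₂, x₃, x₄, x₁].Sublist π ∧ x₁ < x₂ ∧ x₂ < x₃ ∧ x₃ < x₄ := by
  simp only [contains_four_iff, Nat.forall_lt_succ_right]
  refine exists_congr fun _ => exists_congr fun _ => exists_congr fun _ => exists_congr fun _ =>
    and_congr_right fun _ => ?_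
  simp
  omega

theorem contains_3421_iff {π : List ℕ} : Contains π [3, 4, 2, 1] ↔
    ∃ x₃ x₄ x₂ x₁, [x₃, x₄, x₂, x₁].Sublist π ∧ x₁ < x₂ ∧ x₂ < x₃ ∧ x₃ < x₄ := by
  simp only [contains_four_iff, Nat.forall_lt_succ_right]
  refine exists_congr fun _ => exists_congr fun _ => exists_congr fun _ => exists_congr fun _ =>
    and_congr_right fun _ => ?_
  simp
  omega

theorem contains_3241_iff {π : List ℕ} : Contains π [3, 2, 4, 1] ↔
    ∃ x₃ x₂ x₄ x₁, [x₃, x₂, x₄, x₁].Sublist π ∧ x₁ < x₂ ∧ x₂ < x₃ ∧ x₃ < x₄ := by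
  simp only [contains_four_iff, Nat.forall_lt_succ_right]
  refine exists_congr fun _ => exists_congr fun _ => exists_congr fun _ => exists_congr fun _ =>
    and_congr_right fun _ => ?_
  simp
  omega

theorem contains_25314_iff {π : List ℕ} : Contains π [2, 5, 3, 1, 4] ↔
    ∃ x₂ x₅ x₃ x₁ x₄, [x₂, x₅, x₃, x₁, x₄].Sublist π ∧
      x₁ < x₂ ∧ x₂ < x₃ ∧ x₃ < x₄ ∧ x₄ < x₅ := by
  simp only [contains_five_iff, Nat.forall_lt_succ_right]
  refine exists_congr fun _ => exists_congr fun _ => exists_congr fun _ => exists_congr fun _ =>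
    exists_congr fun _ => and_congr_right fun _ => ?_
  simp
  omega

theorem contains_52314_iff {π : List ℕ} : Contains π [5, 2, 3, 1, 4] ↔
    ∃ x₅ x₂ x₃ x₁ x₄, [x₅, x₂, x₃, x₁, x₄].Sublist π ∧
      x₁ < x₂ ∧ x₂ < x₃ ∧ x₃ < x₄ ∧ x₄ < x₅ := by
  simp only [contains_five_iff, Nat.forall_lt_succ_right]
  refine exists_congr fun _ => exists_congr fun _ => exists_congr fun _ => exists_congr fun _ =>
    exists_congr fun _ => and_congr_right fun _ => ?_
  simp
  omega

theorem contains_53214_iff {π : List ℕ} : Contains π [5, 3, 2, 1, 4] ↔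
    ∃ x₅ x₃ x₂ x₁ x₄, [x₅, x₃, x₂, x₁, x₄].Sublist π ∧
      x₁ < x₂ ∧ x₂ < x₃ ∧ x₃ < x₄ ∧ x₄ < x₅ := by
  simp only [contains_five_iff, Nat.forall_lt_succ_right]
  refine exists_congr fun _ => exists_congr fun _ => exists_congr fun _ => exists_congr fun _ =>
    exists_congr fun _ => and_congr_right fun _ => ?_
  simp
  omega

theorem List.idxOf_ne_of_lt {π : List ℕ} {x y : ℕ} (hx : x ∈ π) (hlt : x < y) :
    π.idxOf x ≠ π.idxOf y := fun h => hlt.ne (List.idxOf_inj_of_mem hx h)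

theorem contains_of_between {π : List ℕ} (hnd : π.Nodup) {a b c d : ℕ} (ha : a ∈ π) (hb : b ∈ π)
    (hc : c ∈ π) (hd : d ∈ π) (hca : c < a) (hab : a < b) (hbd : b < d)
    (hac : π.idxOf a < π.idxOf c) (hp : π.idxOf b < π.idxOf d) (hp' : π.idxOf d < π.idxOf c) :
    Contains π [2, 3, 4, 1] ∨ Contains π [3, 4, 2, 1] ∨ Contains π [3, 2, 4, 1] := by
  rw [contains_2341_iff, contains_3421_iff, contains_3241_iff]
  simp only [hnd.sublist_iff_pairwise_idxOf]
  rcases lt_or_gt_of_ne (List.idxOf_ne_of_lt ha hab) with h | h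
  · exact Or.inl ⟨a, b, d, c, ⟨by simp [*], by simp; omega⟩, hca, hab, hbd⟩
  · rcases lt_or_gt_of_ne (List.idxOf_ne_of_lt ha (hab.trans hbd)) with h' | h'
    · exact Or.inr (Or.inr ⟨b, a, d, c, ⟨by simp [*], by simp; omega⟩, hca, hab, hbd⟩)
    · exact Or.inr (Or.inl ⟨b, d, a, c, ⟨by simp [*], by simp; omega⟩, hca, hab, hbd⟩)

theorem contains_of_survives {π : List ℕ} (hnd : π.Nodup) {a b c : ℕ} (ha : a ∈ π) (hb : b ∈ π)
    (hc : c ∈ π) (hca : c < a) (hab : a < b) (hac : π.idxOf a < π.idxOf c)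
    (hbc : Survives π b c) :
    Contains π [2, 3, 4, 1] ∨ Contains π [3, 4, 2, 1] ∨ Contains π [3, 2, 4, 1] ∨
      Contains π [2, 5, 3, 1, 4] ∨ Contains π [5, 2, 3, 1, 4] ∨ Contains π [5, 3, 2, 1, 4] := by
  obtain ⟨hlt, ⟨d, hd, hbd, hp, hp'⟩ | ⟨e, he, m, hm, hbe, hem, hp, hp'⟩ |
    ⟨e, he, m, hm, hbe, hem, hp, hp'⟩⟩ := hbc
  · have := contains_of_between hnd ha hb hc hd hca hab hbd hac hp hp'
    tauto
  · refine Or.inr (Or.inl (contains_3421_iff.2 ⟨e, m, b, c, ?_, hca.trans hab, hbe, hem⟩))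
    rw [hnd.sublist_iff_pairwise_idxOf]
    exact ⟨by simp [*], by simp; omega⟩
  · rcases lt_or_gt_of_ne (List.idxOf_ne_of_lt hc (hca.trans (hab.trans hbe))) with h | h
    · refine Or.inr (Or.inr (Or.inr ?_))
      rw [contains_25314_iff, contains_52314_iff, contains_53214_iff]
      simp only [hnd.sublist_iff_pairwise_idxOf]
      rcases lt_or_gt_of_ne (List.idxOf_ne_of_lt ha (hab.trans (hbe.trans hem))) with h1 | h1
      · exact Or.inl ⟨a, m, b, c, e, ⟨by simp [*], by simp; omega⟩, hca, hab, hbe, hem⟩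
      · rcases lt_or_gt_of_ne (List.idxOf_ne_of_lt ha hab) with h2 | h2
        · exact Or.inr (Or.inl
            ⟨m, a, b, c, e, ⟨by simp [*], by simp; omega⟩, hca, hab, hbe, hem⟩)
        · exact Or.inr (Or.inr
            ⟨m, b, a, c, e, ⟨by simp [*], by simp; omega⟩, hca, hab, hbe, hem⟩)
    · have := contains_of_between hnd ha hb hc he hca hab hbe hac hp' h
      tauto

theorem exists_survives_of_contains {π : List ℕ} (hnd : π.Nodup)
    (h : Contains π [2, 3, 4, 1] ∨ Contains π [3, 4, 2, 1] ∨ Contains π [3, 2, 4, 1] ∨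
      Contains π [2, 5, 3, 1, 4] ∨ Contains π [5, 2, 3, 1, 4] ∨ Contains π [5, 3, 2, 1, 4]) :
    ∃ a ∈ π, ∃ b ∈ π, ∃ c ∈ π, c < a ∧ a < b ∧ Survives π a c ∧ Survives π b c := by
  rw [contains_2341_iff, contains_3421_iff, contains_3241_iff, contains_25314_iff,
    contains_52314_iff, contains_53214_iff] at h
  simp only [hnd.sublist_iff_pairwise_idxOf] at h
  rcases h with ⟨x₂, x₃, x₄, x₁, ⟨hm, hp⟩, h1, h2, h3⟩ | ⟨x₃, x₄, x₂, x₁, ⟨hm, hp⟩, h1, h2, h3⟩ |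
    ⟨x₃, x₂, x₄, x₁, ⟨hm, hp⟩, h1, h2, h3⟩ | ⟨x₂, x₅, x₃, x₁, x₄, ⟨hm, hp⟩, h1, h2, h3, h4⟩ |
    ⟨x₅, x₂, x₃, x₁, x₄, ⟨hm, hp⟩, h1, h2, h3, h4⟩ |
    ⟨x₅, x₃, x₂, x₁, x₄, ⟨hm, hp⟩, h1, h2, h3, h4⟩ <;> simp at hm hp
  · exact ⟨x₂, by tauto, x₃, by tauto, x₁, by tauto, h1, h2,
      ⟨by omega, Or.inl ⟨x₄, by tauto, by omega, by omega, by omega⟩⟩,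
      ⟨by omega, Or.inl ⟨x₄, by tauto, by omega, by omega, by omega⟩⟩⟩
  · exact ⟨x₂, by tauto, x₃, by tauto, x₁, by tauto, h1, h2,
      ⟨by omega, Or.inr (Or.inl ⟨x₃, by tauto, x₄, by tauto, by omega, by omega, by omega,
        by omega⟩)⟩,
      ⟨by omega, Or.inl ⟨x₄, by tauto, by omega, by omega, by omega⟩⟩⟩
  · exact ⟨x₂, by tauto, x₃, by tauto, x₁, by tauto, h1, h2,
      ⟨by omega, Or.inl ⟨x₄, by tauto, by omega, by omega, by omega⟩⟩,
      ⟨by omega, Or.inl ⟨x₄, by tauto, by omega, by omega, by omega⟩⟩⟩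
  · exact ⟨x₂, by tauto, x₃, by tauto, x₁, by tauto, h1, h2,
      ⟨by omega, Or.inl ⟨x₅, by tauto, by omega, by omega, by omega⟩⟩,
      ⟨by omega, Or.inr (Or.inr ⟨x₄, by tauto, x₅, by tauto, by omega, by omega, by omega,
        by omega⟩)⟩⟩
  · exact ⟨x₂, by tauto, x₃, by tauto, x₁, by tauto, h1, h2,
      ⟨by omega, Or.inl ⟨x₃, by tauto, by omega, by omega, by omega⟩⟩,
      ⟨by omega, Or.inr (Or.inr ⟨x₄, by tauto, x₅, by tauto, by omega, by omega, by omega,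
        by omega⟩)⟩⟩
  · exact ⟨x₂, by tauto, x₃, by tauto, x₁, by tauto, h1, h2,
      ⟨by omega, Or.inr (Or.inr ⟨x₄, by tauto, x₅, by tauto, by omega, by omega, by omega,
        by omega⟩)⟩,
      ⟨by omega, Or.inr (Or.inr ⟨x₄, by tauto, x₅, by tauto, by omega, by omega, by omega,
        by omega⟩)⟩⟩

theorem bubblesort_psb_sorts_iff (n : ℕ) (π : List ℕ) (hπ : IsPermList n π) :
    bubblesort (psb π) = List.range' 1 n ↔
      Avoids π [2, 3, 4, 1] ∧ Avoids π [3, 4, 2, 1] ∧ Avoids π [3, 2, 4, 1] ∧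
      Avoids π [2, 5, 3, 1, 4] ∧ Avoids π [5, 2, 3, 1, 4] ∧ Avoids π [5, 3, 2, 1, 4] := by
  have hnd : π.Nodup := hπ.symm.nodup (List.nodup_range' ..)
  have hperm : (bubblesort (psb π)).Perm (List.range' 1 n) :=
    ((bubblesort_perm _).trans (psb_perm π)).trans hπ
  have hsorted : bubblesort (psb π) = List.range' 1 n ↔
      (bubblesort (psb π)).Pairwise (· ≤ ·) :=
    ⟨fun h => h ▸ List.pairwise_le_range' 1, fun h =>
      List.Perm.eq_of_pairwise (fun _ _ _ _ => le_antisymm) h (List.pairwise_le_range' 1) hperm⟩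
  have hbad : (∃ a b c, [a, b, c].Sublist (psb π) ∧ c < a ∧ c < b) ↔
      Contains π [2, 3, 4, 1] ∨ Contains π [3, 4, 2, 1] ∨ Contains π [3, 2, 4, 1] ∨
      Contains π [2, 5, 3, 1, 4] ∨ Contains π [5, 2, 3, 1, 4] ∨ Contains π [5, 3, 2, 1, 4] := by
    rw [exists_inversions_psb_iff hπ]
    refine ⟨?_, exists_survives_of_contains hnd⟩
    rintro ⟨a, ha, b, hb, c, hc, hca, hab, hac, hbc⟩
    exact contains_of_survives hnd ha hb hc hca hab hac.1 hbc
  rw [hsorted, bubblesort_pairwise_iff]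
  simp only [Avoids, ← not_or, ← hbad]
  push Not
  exact forall₃_congr fun a b c => forall_congr' fun _ => by omega
end
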